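/- Up to homeomorphism, there are exactly ten connected T0 topological spaces with exactly four points; that is, the set of topologies on a four-element set that are connected and T0, taken modulo homeomorphism, has exactly ten equivalence classes. -/

import Mathlib

inductive Pt : Type
  | p1 | p2 | p3 | p4
  deriving DecidableEq

open Pt TopologicalSpace

def O1 : Set (Set Pt) :=
  {∅, {p4}, {p1, p4}, {p2, p4}, {p3, p4}, {p1, p2, p4}, {p1, p3, p4}, {p2, p3, p4}, Set.univ}
def O2 : Set (Set Pt) := {∅, {p4}, {p3, p4}, {p2, p3, p4}, {p1, p3, p4}, Set.univ}
def O3 : Set (Set Pt) := {∅, {p4}, {p3, p4}, {p2, p4}, {p2, p3, p4}, Set.univ}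
def O4 : Set (Set Pt) :=
  {∅, {p1}, {p2}, {p3}, {p1, p2}, {p1, p3}, {p2, p3}, {p1, p2, p3}, Set.univ}
def O5 : Set (Set Pt) := {∅, {p1}, {p2}, {p1, p2}, {p1, p2, p3}, Set.univ}
def O6 : Set (Set Pt) := {∅, {p3}, {p4}, {p3, p4}, {p1, p3, p4}, {p2, p3, p4}, Set.univ}
def O7 : Set (Set Pt) := {∅, {p1}, {p1, p2}, {p1, p2, p3}, Set.univ}
def O8 : Set (Set Pt) :=
  {∅, {p1}, {p4}, {p1, p2}, {p1, p4}, {p1, p2, p3}, {p1, p2, p4}, Set.univ}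
def O9 : Set (Set Pt) :=
  {∅, {p1}, {p3}, {p1, p3}, {p3, p4}, {p1, p2, p3}, {p1, p3, p4}, Set.univ}
def O10 : Set (Set Pt) :=
  {∅, {p2}, {p1, p2}, {p2, p3}, {p1, p2, p3}, {p2, p3, p4}, Set.univ}

def X1 : TopologicalSpace Pt := generateFrom O1
def X2 : TopologicalSpace Pt := generateFrom O2
def X3 : TopologicalSpace Pt := generateFrom O3
def X4 : TopologicalSpace Pt := generateFrom O4
def X5 : TopologicalSpace Pt := generateFrom O5
def X6 : TopologicalSpace Pt := generateFrom O6
def X7 : TopologicalSpace Pt := generateFrom O7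
def X8 : TopologicalSpace Pt := generateFrom O8
def X9 : TopologicalSpace Pt := generateFrom O9
def X10 : TopologicalSpace Pt := generateFrom O10

namespace FourPt

/-- the four points as a list -/
def pts : List Pt := [p1, p2, p3, p4]

theorem mem_pts (x : Pt) : x ∈ pts := by cases x <;> simp [pts]

instance : Finite Pt :=
  Finite.of_surjective (fun i : Fin 4 => pts.get i) (by
    intro x
    cases x
    · exact ⟨0, rfl⟩
    · exact ⟨1, rfl⟩
    · exact ⟨2, rfl⟩
    · exact ⟨3, rfl⟩)

/-- function `Pt → α` given by its four values -/
def mk4 {α : Type} (a b c d : α) (x : Pt) : α :=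
  Pt.casesOn x a b c d

theorem mk4_eta {α : Type} (f : Pt → α) : f = mk4 (f p1) (f p2) (f p3) (f p4) := by
  funext x; cases x <;> rfl

/-- reflexive relation given by its off-diagonal entries -/
def mkR (a12 a13 a14 a21 a23 a24 a31 a32 a34 a41 a42 a43 : Bool) : Pt → Pt → Bool :=
  mk4 (mk4 true a12 a13 a14) (mk4 a21 true a23 a24) (mk4 a31 a32 true a34) (mk4 a41 a42 a43 true)

theorem mkR_eta (r : Pt → Pt → Bool) (h : ∀ x, r x x = true) :
    r = mkR (r p1 p2) (r p1 p3) (r p1 p4) (r p2 p1) (r p2 p3) (r p2 p4)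
      (r p3 p1) (r p3 p2) (r p3 p4) (r p4 p1) (r p4 p2) (r p4 p3) := by
  funext x y
  cases x <;> cases y <;> simp [mkR, mk4, h]

/-- upper triangular relation -/
def up (a b c d e f : Bool) : Pt → Pt → Bool :=
  mkR a b c false d e false false f false false false

/-- the ten connected partial orders (entries 12, 13, 14, 23, 24, 34) -/
def rels : List (Pt → Pt → Bool) :=
  [up true true true true true true,
   up true true true false false false,
   up false false true false true true,
   up true true true false true true,
   up true true true true true false,
   up false true true true true true,
   up false true false true true false,
   up false true true true true false,
   up true true true true false false,
   up true false true false true true]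

def rel (i : Fin 10) : Pt → Pt → Bool := rels.get i

/-- Boolean equality -/
def eqb : Bool → Bool → Bool
  | true, b => b
  | false, b => !b

theorem eqb_iff (a b : Bool) : eqb a b = true ↔ a = b := by
  cases a <;> cases b <;> simp [eqb]

def all (p : Pt → Bool) : Bool := p p1 && p p2 && p p3 && p p4

theorem all_iff (p : Pt → Bool) : all p = true ↔ ∀ x, p x = true := by
  constructor
  · intro h x
    simp only [all, Bool.and_eq_true] at h
    obtain ⟨⟨⟨h1, h2⟩, h3⟩, h4⟩ := h
    cases x <;> assumption
  · intro h; simp [all, h]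

def antis (r : Pt → Pt → Bool) : Bool :=
  all fun x => all fun y => !(r x y) || !(r y x) || decide (x = y)
def trns (r : Pt → Pt → Bool) : Bool :=
  all fun x => all fun y => all fun z => !(r x y) || !(r y z) || r x z
def cst (r : Pt → Pt → Bool) (c : Pt → Bool) : Bool :=
  !(all fun x => all fun y => !(r x y) || eqb (c x) (c y)) || all fun x => all fun y => eqb (c x) (c y)
def bools : List Bool := [false, true]
theorem mem_bools (b : Bool) : b ∈ bools := by cases b <;> simp [bools]
def conn (r : Pt → Pt → Bool) : Bool :=
  bools.all fun a => bools.all fun b => bools.all fun c => bools.all fun d => cst r (mk4 a b c d)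
def emb (r s : Pt → Pt → Bool) (f : Pt → Pt) : Bool :=
  all fun x => all fun y => eqb (r (f x) (f y)) (s x y)
def iso (r s : Pt → Pt → Bool) : Bool :=
  pts.any fun a => pts.any fun b => eqb (r a b) (s p1 p2) && (eqb (r b a) (s p2 p1) &&
    pts.any fun c => eqb (r a c) (s p1 p3) && (eqb (r c a) (s p3 p1) && (eqb (r b c) (s p2 p3) &&
      (eqb (r c b) (s p3 p2) && pts.any fun d => emb r s (mk4 a b c d)))))

theorem antis_iff (r : Pt → Pt → Bool) :
    antis r = true ↔ ∀ x y, r x y = true → r y x = true → x = y := by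
  simp only [antis, all_iff]
  refine forall_congr' fun x => forall_congr' fun y => ?_
  cases r x y <;> cases r y x <;> simp

theorem trns_iff (r : Pt → Pt → Bool) :
    trns r = true ↔ ∀ x y z, r x y = true → r y z = true → r x z = true := by
  simp only [trns, all_iff]
  refine forall_congr' fun x => forall_congr' fun y => forall_congr' fun z => ?_
  cases r x y <;> cases r y z <;> simp

theorem cst_iff (r : Pt → Pt → Bool) (c : Pt → Bool) :
    cst r c = true ↔ ((∀ x y, r x y = true → c x = c y) → ∀ x y, c x = c y) := by
  have h : (all fun x => all fun y => !(r x y) || eqb (c x) (c y)) = true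
      ↔ ∀ x y, r x y = true → c x = c y := by
    simp only [all_iff]
    refine forall_congr' fun x => forall_congr' fun y => ?_
    cases r x y <;> simp [eqb_iff]
  have h' : (all fun x => all fun y => eqb (c x) (c y)) = true ↔ ∀ x y, c x = c y := by
    simp [all_iff, eqb_iff]
  rw [← h, ← h', cst]
  generalize (all fun x => all fun y => !(r x y) || eqb (c x) (c y)) = u
  generalize (all fun x => all fun y => eqb (c x) (c y)) = v
  cases u <;> cases v <;> simp

theorem conn_iff (r : Pt → Pt → Bool) : conn r = true ↔
    ∀ c : Pt → Bool, (∀ x y, r x y = true → c x = c y) → ∀ x y, c x = c y := by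
  simp only [conn, List.all_eq_true, cst_iff]
  constructor
  · intro h c
    rw [mk4_eta c]
    exact h _ (mem_bools _) _ (mem_bools _) _ (mem_bools _) _ (mem_bools _)
  · intro h a _ b _ c _ d _
    exact h _

theorem iso_iff (r s : Pt → Pt → Bool) : iso r s = true ↔
    ∃ f : Pt → Pt, ∀ x y, r (f x) (f y) = s x y := by
  simp only [iso, List.any_eq_true, emb, all_iff, eqb_iff, Bool.and_eq_true]
  constructor
  · rintro ⟨a, _, b, _, _, _, c, _, _, _, _, _, d, _, h⟩
    exact ⟨_, h⟩
  · rintro ⟨f, h⟩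
    rw [mk4_eta f] at h
    exact ⟨_, mem_pts _, _, mem_pts _, h p1 p2, h p2 p1, _, mem_pts _, h p1 p3, h p3 p1,
      h p2 p3, h p3 p2, _, mem_pts _, h⟩

def classified (r : Pt → Pt → Bool) : Bool :=
  !(trns r) || (!(conn r) || rels.any fun s => iso r s)

/-- quantify over the two entries of a pair, not both true -/
def pr (p : Bool → Bool → Bool) : Bool := p false false && (p true false && p false true)

theorem pr_spec {p : Bool → Bool → Bool} (h : pr p = true) (a b : Bool)
    (hab : (a && b) = false) : p a b = true := by
  simp only [pr, Bool.and_eq_true] at h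
  cases a <;> cases b <;> simp_all

theorem classified_all : (pr fun a12 a21 => pr fun a13 a31 => pr fun a23 a32 =>
    pr fun a14 a41 => pr fun a24 a42 => pr fun a34 a43 =>
      classified (mkR a12 a13 a14 a21 a23 a24 a31 a32 a34 a41 a42 a43)) = true := by
  decide +kernel

theorem classify (r : Pt → Pt → Bool) (hr : ∀ x, r x x = true) (han : antis r = true) :
    classified r = true := by
  have h : ∀ x y, x ≠ y → (r x y && r y x) = false := by
    intro x y hxy
    by_contra hh
    rw [Bool.not_eq_false, Bool.and_eq_true] at hh
    exact hxy ((antis_iff r).1 han x y hh.1 hh.2)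
  rw [mkR_eta r hr]
  exact pr_spec (pr_spec (pr_spec (pr_spec (pr_spec (pr_spec classified_all
    _ _ (h p1 p2 (by decide))) _ _ (h p1 p3 (by decide))) _ _ (h p2 p3 (by decide)))
    _ _ (h p1 p4 (by decide))) _ _ (h p2 p4 (by decide))) _ _ (h p3 p4 (by decide))

theorem rel_good : ∀ i, (antis (rel i) && trns (rel i) && conn (rel i)
    && all fun x => rel i x x) = true := by
  decide +kernel

theorem rel_inj : ∀ i j, iso (rel i) (rel j) = true → i = j := by
  decide +kernel

theorem rel_antis (i : Fin 10) : ∀ x y, rel i x y = true → rel i y x = true → x = y := by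
  have h := rel_good i
  simp only [Bool.and_eq_true] at h
  exact (antis_iff _).1 h.1.1.1
theorem rel_trns (i : Fin 10) : ∀ x y z, rel i x y = true → rel i y z = true → rel i x z = true := by
  have h := rel_good i
  simp only [Bool.and_eq_true] at h
  exact (trns_iff _).1 h.1.1.2
theorem rel_conn (i : Fin 10) :
    ∀ c : Pt → Bool, (∀ x y, rel i x y = true → c x = c y) → ∀ x y, c x = c y := by
  have h := rel_good i
  simp only [Bool.and_eq_true] at h
  exact (conn_iff _).1 h.1.2
theorem rel_refl (i : Fin 10) : ∀ x, rel i x x = true := by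
  have h := rel_good i
  simp only [Bool.and_eq_true] at h
  exact (all_iff _).1 h.2

/-- topology of down-closed sets -/
def top (r : Pt → Pt → Bool) : TopologicalSpace Pt where
  IsOpen s := ∀ x y, r x y = true → y ∈ s → x ∈ s
  isOpen_univ := fun _ _ _ _ => trivial
  isOpen_inter := fun _ _ hs ht x y h hy => ⟨hs x y h hy.1, ht x y h hy.2⟩
  isOpen_sUnion := fun _ hS x y h ⟨s, hs, hy⟩ => ⟨s, hs, hS s hs x y h hy⟩

theorem top_open (r : Pt → Pt → Bool) (s : Set Pt) :
    @IsOpen Pt (top r) s ↔ ∀ x y, r x y = true → y ∈ s → x ∈ s := Iff.rfl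

theorem top_spec (r : Pt → Pt → Bool) (hr : ∀ x, r x x = true)
    (ht : ∀ x y z, r x y = true → r y z = true → r x z = true) (x y : Pt) :
    @Specializes Pt (top r) x y ↔ r x y = true := by
  let _ := top r
  rw [specializes_iff_forall_open]
  constructor
  · intro h
    exact h {z | r z y = true} (fun a b hab hb => ht a b y hab hb) (hr y)
  · intro h s hs hy
    exact hs x y h hy

theorem top_T0 (r : Pt → Pt → Bool) (hr : ∀ x, r x x = true)
    (ht : ∀ x y z, r x y = true → r y z = true → r x z = true)
    (ha : ∀ x y, r x y = true → r y x = true → x = y) : @T0Space Pt (top r) := by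
  let _ := top r
  refine ⟨fun x y h => ha x y ?_ ?_⟩
  · exact (top_spec r hr ht x y).1 h.specializes
  · exact (top_spec r hr ht y x).1 h.specializes'

theorem top_conn (r : Pt → Pt → Bool)
    (hc : ∀ c : Pt → Bool, (∀ x y, r x y = true → c x = c y) → ∀ x y, c x = c y) :
    @ConnectedSpace Pt (top r) := by
  let _ := top r
  have : PreconnectedSpace Pt := by
    apply preconnectedSpace_of_forall_constant
    intro c hcont x y
    refine hc c (fun a b hab => ?_) x y
    have h := (isOpen_discrete {c b}).preimage hcont
    exact h a b hab rfl
  exact { toNonempty := ⟨p1⟩ }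

theorem exists_rel (t : TopologicalSpace Pt) (h1 : @ConnectedSpace Pt t) (h2 : @T0Space Pt t) :
    ∃ i, Nonempty (@Homeomorph Pt Pt (top (rel i)) t) := by
  classical
  let r : Pt → Pt → Bool := fun x y => decide (x ⤳ y)
  have hrr : ∀ x y, r x y = true ↔ x ⤳ y := fun x y => by simp [r]
  have hopen : ∀ s : Set Pt, IsOpen s ↔ ∀ x y, r x y = true → y ∈ s → x ∈ s := by
    intro s
    simp only [hrr]
    exact isOpen_iff_forall_specializes
  have hrefl : ∀ x, r x x = true := fun x => (hrr x x).2 specializes_rfl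
  have htr : trns r = true := (trns_iff r).2 fun x y z h h' =>
    (hrr _ _).2 (((hrr _ _).1 h).trans ((hrr _ _).1 h'))
  have han : antis r = true := (antis_iff r).2 fun x y h h' =>
    (((hrr _ _).1 h).antisymm ((hrr _ _).1 h')).eq
  have hco : conn r = true := (conn_iff r).2 fun c hc => by
    have : Continuous c := by
      refine ⟨fun s _ => (hopen _).2 fun x y h hy => ?_⟩
      rw [Set.mem_preimage, hc x y h]
      exact hy
    exact fun x y => PreconnectedSpace.constant inferInstance this
  have key := classify r hrefl han
  rw [classified, htr, hco] at key
  simp only [Bool.not_true, Bool.false_or, List.any_eq_true] at key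
  obtain ⟨s, hs, hi⟩ := key
  obtain ⟨i, hsi⟩ := List.get_of_mem hs
  change Fin 10 at i
  change rel i = s at hsi
  subst hsi
  obtain ⟨f, hf⟩ := (iso_iff _ _).1 hi
  have hinj : Function.Injective f := fun x y h =>
    rel_antis i x y (by rw [← hf, h, hrefl]) (by rw [← hf, h, hrefl])
  have hbij : Function.Bijective f := Finite.injective_iff_bijective.1 hinj
  refine ⟨i, ⟨@Equiv.toHomeomorph Pt Pt (top (rel i)) t (Equiv.ofBijective f hbij) fun s => ?_⟩⟩
  rw [top_open, hopen]
  constructor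
  · intro h x y hxy hy
    obtain ⟨a, rfl⟩ := hbij.2 x
    obtain ⟨b, rfl⟩ := hbij.2 y
    exact h a b (by rw [← hf]; exact hxy) hy
  · intro h x y hxy hy
    exact h (f x) (f y) (by rw [hf]; exact hxy) hy

theorem homeo_inj (i j : Fin 10)
    (h : Nonempty (@Homeomorph Pt Pt (top (rel i)) (top (rel j)))) : i = j := by
  obtain ⟨e⟩ := h
  symm
  refine rel_inj j i ((iso_iff _ _).2 ⟨@Homeomorph.toEquiv Pt Pt (top (rel i)) (top (rel j)) e, fun x y => ?_⟩)
  rw [Bool.eq_iff_iff, ← top_spec _ (rel_refl j) (rel_trns j),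
    ← top_spec _ (rel_refl i) (rel_trns i)]
  exact @Topology.IsInducing.specializes_iff Pt Pt (top (rel i)) (top (rel j)) x y _
    (@Homeomorph.isInducing Pt Pt (top (rel i)) (top (rel j)) e)

end FourPt

/-- Up to homeomorphism there are exactly ten connected T0 topologies on a
four-element set. -/
theorem stmt3 :
    Nat.card (Quot (fun (a b : {t : TopologicalSpace Pt // @ConnectedSpace Pt t ∧ @T0Space Pt t}) =>
      Nonempty (@Homeomorph Pt Pt a.1 b.1))) = 10 := by
  let R := fun (a b : {t : TopologicalSpace Pt // @ConnectedSpace Pt t ∧ @T0Space Pt t}) =>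
      Nonempty (@Homeomorph Pt Pt a.1 b.1)
  have hR : Equivalence R :=
    ⟨fun a => ⟨@Homeomorph.refl Pt a.1⟩,
     fun {a b} ⟨e⟩ => ⟨@Homeomorph.symm Pt Pt a.1 b.1 e⟩,
     fun {a b c} ⟨e⟩ ⟨e'⟩ => ⟨@Homeomorph.trans Pt Pt Pt a.1 b.1 c.1 e e'⟩⟩
  let T : Fin 10 → {t : TopologicalSpace Pt // @ConnectedSpace Pt t ∧ @T0Space Pt t} :=
    fun i => ⟨FourPt.top (FourPt.rel i), FourPt.top_conn _ (FourPt.rel_conn i),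
      FourPt.top_T0 _ (FourPt.rel_refl i) (FourPt.rel_trns i) (FourPt.rel_antis i)⟩
  let F : Fin 10 → Quot R := fun i => Quot.mk R (T i)
  have hF : Function.Bijective F := by
    constructor
    · intro i j h
      have h' : R (T i) (T j) := hR.eqvGen_iff.1 (Quot.eqvGen_exact h)
      exact FourPt.homeo_inj i j h'
    · intro q
      induction q using Quot.ind with
      | mk a =>
        obtain ⟨i, hi⟩ := FourPt.exists_rel a.1 a.2.1 a.2.2
        exact ⟨i, Quot.sound hi⟩
  have := Nat.card_eq_of_bijective F hF
  rw [Nat.card_fin] at this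
  exact this.symm
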